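/- Let a, ρ ∈ ℂ and N ∈ ℕ, and assume (a+ρ)ⱼ ≠ 0 for all 0 ≤ j ≤ N and (k+2a−1)_{N+1} ≠ 0 for all 0 ≤ k ≤ N. For 0 ≤ k ≤ N and ℓ ∈ ℕ define the Hahn polynomial value Qₖ(ℓ) = Σ_{j=0}^{k} [ (−k)ⱼ · (−ℓ)ⱼ · (k+2a−1)ⱼ ] / [ (a+ρ)ⱼ · (−N)ⱼ · j! ]. Define aₖ(x) = (x+a)ₖ·(x+1−a−N)_{N−k} and cₗ(x) = (ρ−x)ₗ. Then for every 0 ≤ ℓ ≤ N and all x ∈ ℂ, cₗ(x) = (−1)^N · (a+ρ)ₗ · Σ_{k=0}^{N} [ (2k+2a−1) · (−N)ₖ / ( k! · (k+2a−1)_{N+1} ) ] · Qₖ(ℓ) · aₖ(x). -/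

import Mathlib

/-- The Pochhammer symbol `(z)ₘ = z (z+1) ⋯ (z+m-1)`. -/
noncomputable def poch (z : ℂ) (m : ℕ) : ℂ := ∏ i ∈ Finset.range m, (z + i)

/-- The Hahn polynomial
`Qₖ(ℓ) = ₃F₂(-k, -ℓ, k+2a-1 ; a+ρ, -N ; 1)
       = Σ_{j=0}^{k} (-k)ⱼ (-ℓ)ⱼ (k+2a-1)ⱼ / ((a+ρ)ⱼ (-N)ⱼ j!)`. -/
noncomputable def hahnQ (a ρ : ℂ) (N k l : ℕ) : ℂ :=
  ∑ j ∈ Finset.range (k + 1),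
    (poch (-(k : ℂ)) j * poch (-(l : ℂ)) j * poch ((k : ℂ) + 2 * a - 1) j) /
      (poch (a + ρ) j * poch (-(N : ℂ)) j * (Nat.factorial j : ℂ))

/-- The basis `aₖ(x) = (x+a)ₖ (x+1-a-N)_{N-k}`. -/
noncomputable def aFun (a : ℂ) (N k : ℕ) (x : ℂ) : ℂ :=
  poch (x + a) k * poch (x + 1 - a - N) (N - k)

/-- The basis `cₗ(x) = (ρ-x)ₗ`. -/
noncomputable def cFun (ρ : ℂ) (l : ℕ) (x : ℂ) : ℂ := poch (ρ - x) l

lemma poch_zero (z : ℂ) : poch z 0 = 1 := by simp [poch]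

lemma poch_succ (z : ℂ) (m : ℕ) : poch z (m + 1) = poch z m * (z + m) :=
  Finset.prod_range_succ _ _

lemma poch_add (z : ℂ) (m n : ℕ) : poch z (m + n) = poch z m * poch (z + m) n := by
  simp only [poch, Finset.prod_range_add, Nat.cast_add, add_assoc]

lemma poch_succ_left (z : ℂ) (m : ℕ) : poch z (m + 1) = z * poch (z + 1) m := by
  rw [add_comm, poch_add, poch_succ, poch_zero]
  simp

lemma poch_ne_zero {z : ℂ} {m : ℕ} (h : ∀ i < m, z + i ≠ 0) : poch z m ≠ 0 :=
  Finset.prod_ne_zero_iff.2 fun i hi => h i (Finset.mem_range.1 hi)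

lemma add_natCast_ne_zero_of_poch_ne_zero {z : ℂ} {m i : ℕ} (h : poch z m ≠ 0) (hi : i < m) :
    z + i ≠ 0 :=
  Finset.prod_ne_zero_iff.1 h i (Finset.mem_range.2 hi)

lemma poch_neg_natCast_of_lt {n j : ℕ} (h : n < j) : poch (-(n : ℂ)) j = 0 :=
  Finset.prod_eq_zero (Finset.mem_range.2 h) (by simp)

lemma poch_neg_natCast_mul_factorial (r j : ℕ) :
    poch (-((j + r : ℕ) : ℂ)) j * (r.factorial : ℂ) = (-1) ^ j * ((j + r).factorial : ℂ) := by
  induction j generalizing r with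
  | zero => simp [poch_zero]
  | succ j ih =>
    have h := ih (r + 1)
    rw [Nat.factorial_succ] at h
    rw [poch_succ, pow_succ, show j + 1 + r = j + (r + 1) by ring]
    push_cast at h ⊢
    linear_combination -h

lemma poch_neg_natCast_ne_zero {n j : ℕ} (h : j ≤ n) : poch (-(n : ℂ)) j ≠ 0 := by
  obtain ⟨r, rfl⟩ := Nat.exists_eq_add_of_le h
  refine left_ne_zero_of_mul (b := (r.factorial : ℂ)) ?_
  rw [poch_neg_natCast_mul_factorial]
  exact mul_ne_zero (by simp) (Nat.cast_ne_zero.2 (Nat.factorial_ne_zero _))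

/-- The Chu–Vandermonde identity, in a form without denominators. -/
lemma sum_choose_mul_poch (l : ℕ) (b c : ℂ) :
    ∑ j ∈ Finset.range (l + 1),
      (-1) ^ j * (l.choose j : ℂ) * poch b j * poch (c + j) (l - j) = poch (c - b) l := by
  induction l generalizing b c with
  | zero => simp [poch_zero]
  | succ l ih =>
    have hsplit : ∑ j ∈ Finset.range (l + 1 + 1),
        (-1) ^ j * ((l + 1).choose j : ℂ) * poch b j * poch (c + j) (l + 1 - j) =
        (∑ j ∈ Finset.range (l + 1 + 1),
          (-1) ^ j * (l.choose j : ℂ) * poch b j * poch (c + j) (l + 1 - j)) -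
        ∑ j ∈ Finset.range (l + 1),
          (-1) ^ j * (l.choose j : ℂ) * poch b (j + 1) * poch (c + (j + 1)) (l - j) := by
      rw [Finset.sum_range_succ', Finset.sum_range_succ' _ (l + 1), add_sub_right_comm,
        ← Finset.sum_sub_distrib]
      congr 1
      · refine Finset.sum_congr rfl fun j _ => ?_
        rw [Nat.choose_succ_succ, Nat.add_sub_add_right]
        push_cast
        ring
      · simp
    have hfirst : ∑ j ∈ Finset.range (l + 1 + 1),
        (-1) ^ j * (l.choose j : ℂ) * poch b j * poch (c + j) (l + 1 - j) =
        (c + l) * poch (c - b) l := by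
      rw [Finset.sum_range_succ, Nat.choose_succ_self, ← ih, Finset.mul_sum]
      simp only [Nat.cast_zero, mul_zero, zero_mul, add_zero]
      refine Finset.sum_congr rfl fun j hj => ?_
      obtain ⟨r, rfl⟩ := Nat.exists_eq_add_of_le (Nat.lt_succ_iff.1 (Finset.mem_range.1 hj))
      rw [add_assoc, Nat.add_sub_cancel_left, Nat.add_sub_cancel_left, poch_succ]
      push_cast
      ring
    have hsecond : ∑ j ∈ Finset.range (l + 1),
        (-1) ^ j * (l.choose j : ℂ) * poch b (j + 1) * poch (c + (j + 1)) (l - j) =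
        b * poch (c - b) l := by
      rw [show c - b = c + 1 - (b + 1) by ring, ← ih, Finset.mul_sum]
      refine Finset.sum_congr rfl fun j _ => ?_
      rw [poch_succ_left, show c + (j + 1 : ℂ) = c + 1 + j by ring]
      ring
    rw [hsplit, hfirst, hsecond, poch_succ]
    ring

/-- The Chu–Vandermonde identity. -/
lemma poch_mul_sum_div (l : ℕ) (b c : ℂ) (hc : ∀ j ≤ l, poch c j ≠ 0) :
    poch c l * ∑ j ∈ Finset.range (l + 1),
      poch (-(l : ℂ)) j * poch b j / (poch c j * (j.factorial : ℂ)) = poch (c - b) l := by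
  rw [← sum_choose_mul_poch, Finset.mul_sum]
  refine Finset.sum_congr rfl fun j hj => ?_
  have hjl := Nat.lt_succ_iff.1 (Finset.mem_range.1 hj)
  have hcj := hc j hjl
  obtain ⟨r, rfl⟩ := Nat.exists_eq_add_of_le hjl
  have hr : (r.factorial : ℂ) ≠ 0 := Nat.cast_ne_zero.2 (Nat.factorial_ne_zero _)
  have hj0 : (j.factorial : ℂ) ≠ 0 := Nat.cast_ne_zero.2 (Nat.factorial_ne_zero _)
  have hneg := eq_div_of_mul_eq hr (poch_neg_natCast_mul_factorial r j)
  rw [hneg, Nat.cast_add_choose, Nat.add_sub_cancel_left, poch_add]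
  field_simp

/-- Partial sums of two consecutive instances of the sum in `sum_wellPoised`. -/
lemma sum_range_wellPoised_add (M : ℕ) (A x : ℂ) (h : ∀ i ≤ 2 * (M + 1), 2 * A - 1 + i ≠ 0)
    (n : ℕ) (hn : n ≤ M + 1) :
    ∑ m ∈ Finset.range n,
      ((-1) ^ m * ((M + 1).choose m : ℂ) * (2 * m + 2 * A - 1) * poch (x + A) m *
          poch (x + 1 - A - (M + 1 : ℕ)) (M + 1 - m) / poch (m + 2 * A - 1) (M + 1 + 1) +
        (-1) ^ m * (M.choose m : ℂ) * (2 * m + 2 * A - 1) * poch (x + A) m *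
          poch (x + 1 - A - M) (M - m) / poch (m + 2 * A - 1) (M + 1)) =
      -((-1) ^ n * poch (x + A) n * poch (x + 1 - A - M) (M + 1 - n) *
        (n * ((M + 1).choose n : ℂ) / (M + 1)) / poch (n + 2 * A - 1) (M + 1)) := by
  induction n with
  | zero => simp
  | succ n ih =>
    rw [Finset.sum_range_succ, ih (by omega)]
    obtain ⟨r, rfl⟩ := Nat.exists_eq_add_of_le (show n ≤ M by omega)
    have e1 : n + r + 1 - n = r + 1 := by omega
    have e2 : n + r - n = r := by omega
    have e3 : n + r + 1 - (n + 1) = r := by omega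
    have hM : ((n : ℂ) + r + 1) ≠ 0 := by exact_mod_cast Nat.succ_ne_zero (n + r)
    have hc1 : ((n : ℂ) + 1) * ((n + r + 1).choose (n + 1) : ℂ) =
        ((n + r + 1).choose n : ℂ) * (r + 1) := by
      have := Nat.choose_succ_right_eq (n + r + 1) n
      rw [e1] at this
      rw [mul_comm]
      exact_mod_cast this
    have hc2 : ((n + r).choose n : ℂ) = ((n + r + 1).choose n : ℂ) * (r + 1) / (n + r + 1) := by
      have := Nat.choose_mul_succ_eq (n + r) n
      rw [e1] at this
      rw [eq_div_iff hM]
      exact_mod_cast this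
    have hQ : poch (n + 1 + 2 * A - 1) (n + r) ≠ 0 := poch_ne_zero fun i hi => by
      have := h (n + 1 + i) (by omega)
      push_cast at this
      convert this using 1
      ring
    have h0 : (n + 2 * A - 1 : ℂ) ≠ 0 := by
      convert h n (by omega) using 1
      ring
    have h1 : (n + 1 + 2 * A - 1 + (n + r) : ℂ) ≠ 0 := by
      have := h (n + 1 + (n + r)) (by omega)
      push_cast at this
      convert this using 1
      ring
    have p1 : poch (n + 2 * A - 1) (n + r + 1) =
        (n + 2 * A - 1) * poch (n + 1 + 2 * A - 1) (n + r) := by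
      rw [poch_succ_left]
      ring_nf
    have p2 : poch (n + 2 * A - 1) (n + r + 1 + 1) = (n + 2 * A - 1) *
        (poch (n + 1 + 2 * A - 1) (n + r) * (n + 1 + 2 * A - 1 + (n + r))) := by
      rw [poch_succ, p1]
      push_cast
      ring
    have p3 : poch ((n + 1 : ℕ) + 2 * A - 1) (n + r + 1) =
        poch (n + 1 + 2 * A - 1) (n + r) * (n + 1 + 2 * A - 1 + (n + r)) := by
      rw [poch_succ]
      push_cast
      ring
    have p4 : poch (x + 1 - A - (n + r + 1 : ℕ)) (r + 1) =
        (x - A - (n + r)) * poch (x + 1 - A - (n + r : ℕ)) r := by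
      rw [poch_succ_left]
      push_cast
      ring_nf
    have p5 : poch (x + 1 - A - (n + r : ℕ)) (r + 1) =
        poch (x + 1 - A - (n + r : ℕ)) r * (x + 1 - A - n) := by
      rw [poch_succ]
      push_cast
      ring
    rw [e1, e2, e3, p1, p2, p3, p4, p5, poch_succ (x + A), hc2, pow_succ]
    rw [show ((n + 1 : ℕ) : ℂ) * ((n + r + 1).choose (n + 1) : ℂ) =
      ((n + r + 1).choose n : ℂ) * (r + 1) by exact_mod_cast hc1]
    generalize poch (n + 1 + 2 * A - 1) (n + r) = Q at *
    generalize poch (x + 1 - A - (n + r : ℕ)) r = R at *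
    generalize hV : (n + 2 * A - 1 : ℂ) = V at *
    generalize hW : (n + 1 + 2 * A - 1 + (n + r) : ℂ) = W at *
    push_cast
    field_simp
    rw [← hV, ← hW]
    ring

/-- A terminating very-well-poised summation. -/
lemma sum_wellPoised (M : ℕ) (A x : ℂ) (h : ∀ i ≤ 2 * M, 2 * A - 1 + i ≠ 0) :
    ∑ m ∈ Finset.range (M + 1),
      (-1) ^ m * (M.choose m : ℂ) * (2 * m + 2 * A - 1) * poch (x + A) m *
        poch (x + 1 - A - M) (M - m) / poch (m + 2 * A - 1) (M + 1) = (-1) ^ M := by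
  induction M with
  | zero =>
    have := h 0 le_rfl
    simp only [Nat.cast_zero, add_zero] at this
    simp [poch_zero, poch_succ, this]
  | succ M ih =>
    have hadd := sum_range_wellPoised_add M A x h (M + 1) le_rfl
    rw [Finset.sum_add_distrib, ih fun i hi => h i (by omega)] at hadd
    rw [Finset.sum_range_succ, eq_sub_of_add_eq hadd, poch_succ (_ + 2 * A - 1) (M + 1)]
    have hQ : poch ((M + 1 : ℕ) + 2 * A - 1) (M + 1) ≠ 0 := poch_ne_zero fun i hi => by
      have := h (M + 1 + i) (by omega)
      push_cast at this ⊢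
      convert this using 1
      ring
    have h1 : ((M + 1 : ℕ) + 2 * A - 1 + (M + 1 : ℕ) : ℂ) ≠ 0 := by
      have := h (M + 1 + (M + 1)) (by omega)
      push_cast at this ⊢
      convert this using 1
      ring
    have hM : (M + 1 : ℂ) ≠ 0 := by exact_mod_cast Nat.succ_ne_zero M
    have h2 : (2 * (M + 1 : ℕ) + 2 * A - 1 : ℂ) = (M + 1 : ℕ) + 2 * A - 1 + (M + 1 : ℕ) := by
      ring
    rw [h2]
    generalize poch ((M + 1 : ℕ) + 2 * A - 1) (M + 1) = Q at *
    generalize ((M + 1 : ℕ) + 2 * A - 1 + (M + 1 : ℕ) : ℂ) = W at *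
    simp only [Nat.choose_self, Nat.sub_self, poch_zero, Nat.cast_one]
    push_cast
    field_simp
    ring

/-- The functions `aₖ` expand the multiples `(x+a)ⱼ`. -/
lemma sum_mul_aFun (a : ℂ) (N : ℕ)
    (h2 : ∀ k ≤ N, poch ((k : ℂ) + 2 * a - 1) (N + 1) ≠ 0) (x : ℂ) (j : ℕ) (hj : j ≤ N) :
    ∑ k ∈ Finset.range (N + 1),
      (2 * (k : ℂ) + 2 * a - 1) * poch (-(N : ℂ)) k /
          ((k.factorial : ℂ) * poch ((k : ℂ) + 2 * a - 1) (N + 1)) *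
        (poch (-(k : ℂ)) j * poch ((k : ℂ) + 2 * a - 1) j) * aFun a N k x =
      (-1) ^ N * poch (-(N : ℂ)) j * poch (x + a) j := by
  obtain ⟨M, rfl⟩ := Nat.exists_eq_add_of_le hj
  have hM : (M.factorial : ℂ) ≠ 0 := Nat.cast_ne_zero.2 (Nat.factorial_ne_zero _)
  have hnz : ∀ i ≤ 2 * M, 2 * (a + j) - 1 + i ≠ 0 := fun i hi => by
    have := add_natCast_ne_zero_of_poch_ne_zero (h2 (j + i / 2) (by omega))
      (show j + (i - i / 2) < j + M + 1 by omega)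
    have hi2 : ((i / 2 : ℕ) : ℂ) + ((i - i / 2 : ℕ) : ℂ) = i := by
      exact_mod_cast Nat.add_sub_cancel' (Nat.div_le_self i 2)
    intro h0
    apply this
    rw [← h0, ← hi2]
    push_cast
    ring
  rw [add_assoc, Finset.sum_range_add, Finset.sum_eq_zero, zero_add]
  · have hsum := sum_wellPoised M (a + j) x hnz
    rw [eq_div_of_mul_eq hM (poch_neg_natCast_mul_factorial M j)]
    have hsign : ((-1 : ℂ)) ^ (j + M) * ((-1) ^ j * ((j + M).factorial : ℂ) / M.factorial) *
        poch (x + a) j = (j + M).factorial / M.factorial * poch (x + a) j * (-1) ^ M := by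
      rw [pow_add]
      have : ((-1 : ℂ)) ^ j * (-1) ^ j = 1 := by rw [← mul_pow]; simp
      linear_combination
        ((-1) ^ M * ((j + M).factorial : ℂ) / M.factorial * poch (x + a) j) * this
    rw [hsign, ← hsum, Finset.mul_sum]
    refine Finset.sum_congr rfl fun m hm => ?_
    have hmM := Nat.lt_succ_iff.1 (Finset.mem_range.1 hm)
    have hp := h2 (j + m) (by omega)
    obtain ⟨r, rfl⟩ := Nat.exists_eq_add_of_le hmM
    have e1 : j + (m + r) - (j + m) = r := by omega
    have e2 : m + r - m = r := by omega
    have hr : (r.factorial : ℂ) ≠ 0 := Nat.cast_ne_zero.2 (Nat.factorial_ne_zero _)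
    have hm0 : (m.factorial : ℂ) ≠ 0 := Nat.cast_ne_zero.2 (Nat.factorial_ne_zero _)
    have hk : ((j + m).factorial : ℂ) ≠ 0 := Nat.cast_ne_zero.2 (Nat.factorial_ne_zero _)
    have q1 := eq_div_of_mul_eq hr (poch_neg_natCast_mul_factorial r (j + m))
    have q2 := eq_div_of_mul_eq hm0 (poch_neg_natCast_mul_factorial m j)
    have q3 : poch (((j + m : ℕ) : ℂ) + 2 * a - 1) (j + (m + r) + 1) =
        poch (((j + m : ℕ) : ℂ) + 2 * a - 1) j * poch (m + 2 * (a + j) - 1) (m + r + 1) := by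
      rw [add_assoc j, poch_add]
      push_cast
      ring_nf
    rw [q3] at hp
    have hp1 := left_ne_zero_of_mul hp
    have hp2 := right_ne_zero_of_mul hp
    have q4 : poch (x + 1 - a - (j + (m + r) : ℕ)) r =
        poch (x + 1 - (a + j) - (m + r : ℕ)) r := by
      push_cast
      ring_nf
    have q5 : (2 * ((j + m : ℕ) : ℂ) + 2 * a - 1) = 2 * m + 2 * (a + j) - 1 := by
      push_cast
      ring
    rw [← add_assoc j (m + r) 1, q3, aFun, e1, e2, q4, q5, ← add_assoc j m r, q1, q2,
      poch_add (x + a) j m, add_assoc x a j, Nat.cast_add_choose, pow_add]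
    have hs : ((-1 : ℂ)) ^ j * (-1) ^ j = 1 := by rw [← mul_pow]; simp
    generalize poch (x + (a + j)) m = P
    generalize poch (x + 1 - (a + j) - (m + r : ℕ)) r = R
    field_simp
    linear_combination ((2 * m + 2 * (a + j) - 1) * ((j + m + r).factorial : ℂ) *
      poch (x + a) j * P * R) * hs
  · intro k hk
    simp [poch_neg_natCast_of_lt (Finset.mem_range.1 hk)]

lemma hahnQ_eq_sum_range (a ρ : ℂ) {N k : ℕ} (l : ℕ) (hk : k ≤ N) :
    hahnQ a ρ N k l = ∑ j ∈ Finset.range (N + 1),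
      (poch (-(k : ℂ)) j * poch (-(l : ℂ)) j * poch ((k : ℂ) + 2 * a - 1) j) /
        (poch (a + ρ) j * poch (-(N : ℂ)) j * (Nat.factorial j : ℂ)) := by
  refine Finset.sum_subset (Finset.range_subset_range.2 (by omega)) fun j _ hj => ?_
  rw [poch_neg_natCast_of_lt (by simpa using hj)]
  simp

/-- Overlap formula expanding `cₗ` over the basis `aₖ` with Hahn polynomial coefficients:
`cₗ = (-1)^N (a+ρ)ₗ Σ_{k=0}^{N} ((2k+2a-1) (-N)ₖ / (k! (k+2a-1)_{N+1})) Qₖ(ℓ) aₖ`. -/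
theorem c_in_terms_of_a (a ρ : ℂ) (N : ℕ)
    (h1 : ∀ j ≤ N, poch (a + ρ) j ≠ 0)
    (h2 : ∀ k ≤ N, poch ((k : ℂ) + 2 * a - 1) (N + 1) ≠ 0)
    (l : ℕ) (hl : l ≤ N) (x : ℂ) :
    cFun ρ l x =
      (-1 : ℂ) ^ N * poch (a + ρ) l *
        ∑ k ∈ Finset.range (N + 1),
          ((2 * (k : ℂ) + 2 * a - 1) * poch (-(N : ℂ)) k /
              ((Nat.factorial k : ℂ) * poch ((k : ℂ) + 2 * a - 1) (N + 1)))
            * hahnQ a ρ N k l * aFun a N k x := by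
  have hswap : ∑ k ∈ Finset.range (N + 1),
      ((2 * (k : ℂ) + 2 * a - 1) * poch (-(N : ℂ)) k /
          ((Nat.factorial k : ℂ) * poch ((k : ℂ) + 2 * a - 1) (N + 1)))
        * hahnQ a ρ N k l * aFun a N k x =
      ∑ j ∈ Finset.range (N + 1),
        (-1) ^ N * (poch (-(l : ℂ)) j * poch (x + a) j / (poch (a + ρ) j * (j.factorial : ℂ))) := by
    rw [Finset.sum_congr rfl fun k hk => by
      rw [hahnQ_eq_sum_range a ρ l (Nat.lt_succ_iff.1 (Finset.mem_range.1 hk)),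
        Finset.mul_sum, Finset.sum_mul], Finset.sum_comm]
    refine Finset.sum_congr rfl fun j hj => ?_
    have hjN := Nat.lt_succ_iff.1 (Finset.mem_range.1 hj)
    have hN := poch_neg_natCast_ne_zero hjN
    have hsum := sum_mul_aFun a N h2 x j hjN
    calc _ = poch (-(l : ℂ)) j / (poch (a + ρ) j * poch (-(N : ℂ)) j * (j.factorial : ℂ)) *
          ((-1) ^ N * poch (-(N : ℂ)) j * poch (x + a) j) := by
          rw [← hsum, Finset.mul_sum]
          exact Finset.sum_congr rfl fun k _ => by ring
      _ = _ := by
          have hρ := h1 j hjN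
          have hj0 : (j.factorial : ℂ) ≠ 0 := Nat.cast_ne_zero.2 (Nat.factorial_ne_zero _)
          field_simp
  have hshrink : ∑ j ∈ Finset.range (l + 1),
      poch (-(l : ℂ)) j * poch (x + a) j / (poch (a + ρ) j * (j.factorial : ℂ)) =
      ∑ j ∈ Finset.range (N + 1),
        poch (-(l : ℂ)) j * poch (x + a) j / (poch (a + ρ) j * (j.factorial : ℂ)) := by
    refine Finset.sum_subset (Finset.range_subset_range.2 (by omega)) fun j _ hj => ?_
    rw [poch_neg_natCast_of_lt (by simpa using hj)]
    simp
  have hcv := poch_mul_sum_div l (x + a) (a + ρ) fun j hj => h1 j (hj.trans hl)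
  have hsign : ((-1 : ℂ)) ^ N * (-1) ^ N = 1 := by rw [← mul_pow]; simp
  rw [hswap, ← Finset.mul_sum, ← hshrink, cFun, show ρ - x = a + ρ - (x + a) by ring, ← hcv]
  linear_combination -(poch (a + ρ) l * ∑ j ∈ Finset.range (l + 1),
    poch (-(l : ℂ)) j * poch (x + a) j / (poch (a + ρ) j * (j.factorial : ℂ))) * hsign
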